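/- Let (R,m,k) be a Noetherian local ring, let M be a nonzero finitely generated R-module with g = grade(M), and let ⋯ → F_1 → F_0 → 0 be a minimal free resolution of M over R. Then the R-dual complex 0 → F_0^* → F_1^* → ⋯ → F_g^* → 0 of the truncation 0 → F_g → ⋯ → F_0 → 0 is a minimal free resolution of E_R(M) = coker( ∂_g^* : F_{g−1}^* → F_g^* ) over R. -/

import Mathlib

open CategoryTheory IsLocalRing

universe u

/-- `extMod S n A B` is the `n`-th Ext module `Ext_S^n(A, B)` of `S`-modules `A` and `B`,
realized as an object of `ModuleCat S`. -/
noncomputable def extMod (S : Type u) [CommRing S] (n : ℕ)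
    (A : Type u) [AddCommGroup A] [Module S A] (B : Type u) [AddCommGroup B] [Module S B] :
    ModuleCat.{u} S :=
  ((Ext S (ModuleCat.{u} S) n).obj (Opposite.op (ModuleCat.of S A))).obj (ModuleCat.of S B)

/-- `moduleGrade S M = inf { n | Ext_S^n(M, S) ≠ 0 }`. -/
noncomputable def moduleGrade (S : Type u) [CommRing S]
    (M : Type u) [AddCommGroup M] [Module S M] : ℕ :=
  sInf {n : ℕ | ¬ Subsingleton (extMod S n M S)}

/-- A minimal free resolution `⋯ → F₁ → F₀ → M → 0` of a module `M` over a local ring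
`(R, m)`: each `Fₙ` is finite free, the complex is exact (a resolution of `M`), and each
differential maps into `m • Fₙ` (minimality). -/
structure MinimalFreeResolution (R : Type u) [CommRing R] [IsLocalRing R]
    (M : Type u) [AddCommGroup M] [Module R M] : Type (u + 1) where
  F : ℕ → Type u
  [acg : ∀ n, AddCommGroup (F n)]
  [mod : ∀ n, Module R (F n)]
  free : ∀ n, Module.Free R (F n)
  finite : ∀ n, Module.Finite R (F n)
  /-- the differential `∂_{n+1} : F_{n+1} → F_n` -/
  d : ∀ n, F (n + 1) →ₗ[R] F n
  /-- the augmentation `F₀ → M` -/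
  aug : F 0 →ₗ[R] M
  aug_surjective : Function.Surjective aug
  exact_at_zero : LinearMap.range (d 0) = LinearMap.ker aug
  exact : ∀ n, LinearMap.range (d (n + 1)) = LinearMap.ker (d n)
  minimal : ∀ n, LinearMap.range (d n) ≤ (maximalIdeal R) • (⊤ : Submodule R (F n))

attribute [instance] MinimalFreeResolution.acg MinimalFreeResolution.mod

variable {R : Type u} [CommRing R] [IsLocalRing R]
  {M : Type u} [AddCommGroup M] [Module R M]

/-- The image of the dualized differential `∂_g^* : F_{g-1}^* → F_g^*`
(interpreted as `⊥ ⊆ F₀^*` when `g = 0`, since `F_{-1} = 0`). -/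
noncomputable def codual (res : MinimalFreeResolution R M) :
    ∀ g : ℕ, Submodule R (Module.Dual R (res.F g))
  | 0 => ⊥
  | g' + 1 => LinearMap.range (res.d g').dualMap

/-- `E_R(M) = coker ( ∂_g^* : F_{g-1}^* → F_g^* )`, where `g = grade M` and `F_•` is a
minimal free resolution of `M`. -/
noncomputable abbrev ERes (res : MinimalFreeResolution R M) (g : ℕ) : Type u :=
  Module.Dual R (res.F g) ⧸ codual res g

theorem CategoryTheory.ProjectiveResolution.exactAt_linearYonedaObj {S : Type u} [CommRing S]
    {X : ModuleCat.{u} S}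
    (P : ProjectiveResolution X) (n : ℕ) (Y : ModuleCat.{u} S)
    (h : Subsingleton (((Ext S (ModuleCat.{u} S) n).obj (Opposite.op X)).obj Y)) :
    (P.complex.linearYonedaObj S Y).ExactAt n := by
  rw [HomologicalComplex.exactAt_iff_isZero_homology]
  exact (ModuleCat.isZero_of_subsingleton _).of_iso (P.isoExt n Y).symm

theorem CategoryTheory.ProjectiveResolution.eq_zero_of_subsingleton_ext_zero {S : Type u}
    [CommRing S] {X : ModuleCat.{u} S}
    (P : ProjectiveResolution X) (Y : ModuleCat.{u} S)
    (h : Subsingleton (((Ext S (ModuleCat.{u} S) 0).obj (Opposite.op X)).obj Y))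
    (f : P.complex.X 0 ⟶ Y) (hf : P.complex.d 1 0 ≫ f = 0) : f = 0 := by
  have := P.exactAt_linearYonedaObj 0 Y h
  rw [HomologicalComplex.exactAt_iff' _ 0 0 1 (by simp) (by simp),
    ShortComplex.moduleCat_exact_iff] at this
  obtain ⟨g, hg⟩ := this f hf
  rw [← hg]
  change P.complex.d 0 0 ≫ g = 0
  rw [P.complex.shape 0 0 (by simp)]
  exact Limits.zero_comp

theorem CategoryTheory.ProjectiveResolution.exists_comp_eq_of_subsingleton_ext_succ
    {S : Type u} [CommRing S] {X : ModuleCat.{u} S} (P : ProjectiveResolution X) (n : ℕ)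
    (Y : ModuleCat.{u} S)
    (h : Subsingleton (((Ext S (ModuleCat.{u} S) (n + 1)).obj (Opposite.op X)).obj Y))
    (f : P.complex.X (n + 1) ⟶ Y) (hf : P.complex.d (n + 2) (n + 1) ≫ f = 0) :
    ∃ g : P.complex.X n ⟶ Y, P.complex.d (n + 1) n ≫ g = f := by
  have := P.exactAt_linearYonedaObj (n + 1) Y h
  rw [HomologicalComplex.exactAt_iff' _ n (n + 1) (n + 2) (by simp) (by simp),
    ShortComplex.moduleCat_exact_iff] at this
  exact this f hf

namespace MinimalFreeResolution

variable (res : MinimalFreeResolution R M)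

/-- The chain complex of modules underlying a minimal free resolution. -/
noncomputable abbrev complex : ChainComplex (ModuleCat.{u} R) ℕ :=
  ChainComplex.of (fun n ↦ ModuleCat.of R (res.F n)) (fun n ↦ ModuleCat.ofHom (res.d n))
    (fun n ↦ by
      ext x
      exact (res.exact n).le ⟨x, rfl⟩)

theorem complex_d (n : ℕ) : res.complex.d (n + 1) n = ModuleCat.ofHom (res.d n) :=
  ChainComplex.of_d (fun n ↦ ModuleCat.of R (res.F n)) (fun n ↦ ModuleCat.ofHom (res.d n)) n

theorem complex_d_comp_aug : res.complex.d 1 0 ≫ ModuleCat.ofHom res.aug = 0 := by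
  rw [complex_d]
  ext x
  exact res.exact_at_zero.le ⟨x, rfl⟩

/-- The augmentation as a map of complexes to `M` in degree zero. -/
noncomputable def augmentation :
    res.complex ⟶ (ChainComplex.single₀ (ModuleCat.{u} R)).obj (ModuleCat.of R M) :=
  (ChainComplex.toSingle₀Equiv res.complex (ModuleCat.of R M)).symm
    ⟨ModuleCat.ofHom res.aug, res.complex_d_comp_aug⟩

theorem augmentation_f_zero : res.augmentation.f 0 = ModuleCat.ofHom res.aug :=
  ChainComplex.toSingle₀Equiv_symm_apply_f_zero _ _

theorem complex_exactAt_succ (n : ℕ) : res.complex.ExactAt (n + 1) := by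
  rw [HomologicalComplex.exactAt_iff' _ (n + 2) (n + 1) n (by simp) (by simp),
    ShortComplex.moduleCat_exact_iff_range_eq_ker]
  change LinearMap.range (res.complex.d (n + 1 + 1) (n + 1)).hom =
    LinearMap.ker (res.complex.d (n + 1) n).hom
  rw [complex_d, complex_d]
  exact res.exact n

instance quasiIso_augmentation : QuasiIso res.augmentation := by
  refine ⟨fun n ↦ ?_⟩
  cases n with
  | zero =>
    rw [ChainComplex.quasiIsoAt₀_iff,
      ShortComplex.quasiIso_iff_of_zeros' _ (res.complex.shape 0 0 (by simp)) rfl rfl]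
    constructor
    · rw [ShortComplex.moduleCat_exact_iff_range_eq_ker]
      change LinearMap.range (res.complex.d (0 + 1) 0).hom =
        LinearMap.ker (res.augmentation.f 0).hom
      rw [complex_d, augmentation_f_zero]
      exact res.exact_at_zero
    · change Epi (res.augmentation.f 0)
      rw [augmentation_f_zero]
      exact (ModuleCat.epi_iff_surjective _).2 res.aug_surjective
  | succ n =>
    rw [quasiIsoAt_iff_exactAt' _ _ (ChainComplex.exactAt_succ_single_obj _ _)]
    exact res.complex_exactAt_succ n

/-- A minimal free resolution as a projective resolution in the category of modules. -/
noncomputable def toProjectiveResolution : ProjectiveResolution (ModuleCat.of R M) where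
  complex := res.complex
  projective n := by
    have := res.free n
    exact (IsProjective.iff_projective (R := R) (res.F n)).1 inferInstance
  π := res.augmentation

theorem eq_zero_of_comp_d_eq_zero (h : Subsingleton (extMod R 0 M R))
    (f : Module.Dual R (res.F 0)) (hf : f ∘ₗ res.d 0 = 0) : f = 0 := by
  have := res.toProjectiveResolution.eq_zero_of_subsingleton_ext_zero (ModuleCat.of R R) h
    (ModuleCat.ofHom f) (by
      change res.complex.d (0 + 1) 0 ≫ _ = 0
      rw [complex_d, ← ModuleCat.ofHom_comp, hf]
      rfl)
  exact congrArg ModuleCat.Hom.hom this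

theorem exists_comp_d_eq (n : ℕ) (h : Subsingleton (extMod R (n + 1) M R))
    (f : Module.Dual R (res.F (n + 1))) (hf : f ∘ₗ res.d (n + 1) = 0) :
    ∃ g : Module.Dual R (res.F n), g ∘ₗ res.d n = f := by
  obtain ⟨g, hg⟩ := res.toProjectiveResolution.exists_comp_eq_of_subsingleton_ext_succ n
    (ModuleCat.of R R) h (ModuleCat.ofHom f) (by
      change res.complex.d (n + 1 + 1) (n + 1) ≫ _ = 0
      rw [complex_d, ← ModuleCat.ofHom_comp, hf]
      rfl)
  change res.complex.d (n + 1) n ≫ _ = _ at hg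
  rw [complex_d] at hg
  exact ⟨g.hom, congrArg ModuleCat.Hom.hom hg⟩

theorem d_comp_d (n : ℕ) : res.d n ∘ₗ res.d (n + 1) = 0 := by
  ext x
  exact (res.exact n).le ⟨x, rfl⟩

end MinimalFreeResolution

theorem subsingleton_extMod_of_lt_moduleGrade {S : Type u} [CommRing S] {A : Type u}
    [AddCommGroup A] [Module S A] {n : ℕ} (h : n < moduleGrade S A) :
    Subsingleton (extMod S n A S) :=
  not_not.1 (Nat.notMem_of_lt_sInf h)

/-- A functional on a finite free module with values in an ideal `I` lies in `I • F^*`. -/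
theorem Module.Dual.mem_smul_top_of_forall_mem {S F : Type*} [CommRing S] [AddCommGroup F]
    [Module S F] [Module.Free S F] [Module.Finite S F] (I : Ideal S) (f : Module.Dual S F)
    (h : ∀ x, f x ∈ I) : f ∈ I • (⊤ : Submodule S (Module.Dual S F)) := by
  classical
  let b := Module.Free.chooseBasis S F
  rw [← b.sum_dual_apply_smul_coord f]
  exact Submodule.sum_mem _ fun i _ ↦ Submodule.smul_mem_smul (h _) trivial

theorem LinearMap.range_dualMap_le_smul_top {S F G : Type*} [CommRing S] [AddCommGroup F]
    [Module S F] [AddCommGroup G] [Module S G] [Module.Free S G] [Module.Finite S G]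
    (I : Ideal S) (d : G →ₗ[S] F) (h : LinearMap.range d ≤ I • (⊤ : Submodule S F)) :
    LinearMap.range d.dualMap ≤ I • (⊤ : Submodule S (Module.Dual S G)) := by
  rintro _ ⟨f, rfl⟩
  refine Module.Dual.mem_smul_top_of_forall_mem I _ fun x ↦ ?_
  have := Submodule.smul_top_le_comap_smul_top I f (h ⟨x, rfl⟩)
  rwa [Submodule.mem_comap, smul_eq_mul, Ideal.mul_top] at this

/-- For a nonzero finitely generated module `M` over a Noetherian local ring `R` with
`g = grade M` and minimal free resolution `(F_•, ∂_•)`, the dual complex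
`0 → F₀^* → F₁^* → ⋯ → F_g^*` of the truncation `0 → F_g → ⋯ → F₀ → 0`, together with the
projection `F_g^* → E_R(M) = coker ∂_g^*`, is a minimal free resolution of `E_R(M)`:
all terms are finite free, the complex augmented by `E_R(M)` is exact, and each dualized
differential lands in `m • F_{n+1}^*`. -/
theorem dual_complex_is_minimal_free_resolution [IsNoetherianRing R]
    [Module.Finite R M] (hM : Nontrivial M)
    (res : MinimalFreeResolution R M) :
    -- the terms `F_n^*` for `n ≤ g` are finite free `R`-modules
    (∀ n ≤ moduleGrade R M,
        Module.Free R (Module.Dual R (res.F n)) ∧ Module.Finite R (Module.Dual R (res.F n))) ∧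
    -- exactness at `F₀^*`, i.e. `0 → F₀^* → F₁^*` is exact (when `g ≥ 1`)
    (1 ≤ moduleGrade R M → Function.Injective ((res.d 0).dualMap)) ∧
    -- exactness at the middle terms `F_{n+1}^*` for `n + 2 ≤ g`
    (∀ n : ℕ, n + 2 ≤ moduleGrade R M →
        LinearMap.range ((res.d n).dualMap) = LinearMap.ker ((res.d (n + 1)).dualMap)) ∧
    -- exactness at `F_g^*`: the image of `∂_g^*` is the kernel of `F_g^* → E_R(M)`,
    -- and the augmentation `F_g^* → E_R(M)` is surjective
    (∀ g' : ℕ, moduleGrade R M = g' + 1 →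
        Function.Exact ((res.d g').dualMap) ((codual res (g' + 1)).mkQ)) ∧
    Function.Surjective ((codual res (moduleGrade R M)).mkQ) ∧
    -- when `g = 0`, the resolution is `0 → F₀^* → E_R(M) → 0`
    (moduleGrade R M = 0 → Function.Injective ((codual res 0).mkQ)) ∧
    -- minimality: each dualized differential maps into `m • F_{n+1}^*`
    (∀ n : ℕ, n + 1 ≤ moduleGrade R M →
        LinearMap.range ((res.d n).dualMap) ≤
          (maximalIdeal R) • (⊤ : Submodule R (Module.Dual R (res.F (n + 1))))) := by
  have hext {n : ℕ} (h : n < moduleGrade R M) := subsingleton_extMod_of_lt_moduleGrade h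
  have hfree := res.free
  have hfinite := res.finite
  refine ⟨fun n _ ↦ ⟨inferInstance, inferInstance⟩, fun h ↦ ?_, fun n h ↦ ?_, fun g' _ ↦ ?_,
    Submodule.mkQ_surjective _, fun _ ↦ ?_, fun n _ ↦ ?_⟩
  · rw [← LinearMap.ker_eq_bot, LinearMap.ker_eq_bot']
    exact fun f hf ↦ res.eq_zero_of_comp_d_eq_zero (hext h) f hf
  · refine le_antisymm ?_ fun f hf ↦ res.exists_comp_d_eq n (hext h) f hf
    rintro _ ⟨f, rfl⟩
    change (f ∘ₗ res.d n) ∘ₗ res.d (n + 1) = 0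
    rw [LinearMap.comp_assoc, res.d_comp_d, LinearMap.comp_zero]
  · rw [LinearMap.exact_iff, Submodule.ker_mkQ]
    rfl
  · rw [← LinearMap.ker_eq_bot, Submodule.ker_mkQ]
    rfl
  · exact LinearMap.range_dualMap_le_smul_top _ _ (res.minimal n)
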